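/- arXiv:1309.4930 — 2 statements merged into one kernel-verified Lean document; each statement's English description precedes it below -/
import Mathlib

section
/- For every ε-noise channel W (0 ≤ ε < 1) with input alphabet X and output alphabet Y, the zero-undetected-error capacity satisfies C_eo(W) ≤ log( e^{C_sp(W)} + ε·|X|·(|Y|−1) ), where C_sp(W) is the Sperner capacity of the channel and log denotes the natural logarithm. -/
open scoped Classical
open Real Finset

/-- The `n`-letter extension of the channel `W` (here `W x y` is the probability
`W(y|x)` of receiving `y` given that `x` was sent). -/
noncomputable def Wn {Y : Type*} (W : Y → Y → ℝ) (n : ℕ) (x y : Fin n → Y) : ℝ :=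
  ∏ j, W (x j) (y j)

/-- The probability of erasure given that message `m` was sent, when the codebook
`c` is used with a zero-undetected-error decoder. -/
noncomputable def erasureProb {Y : Type*} [Fintype Y] (W : Y → Y → ℝ) {n M : ℕ}
    (c : Fin M → Fin n → Y) (m : Fin M) : ℝ :=
  ∑ y ∈ Finset.univ.filter (fun y : Fin n → Y =>
      1 < (Finset.univ.filter (fun m' : Fin M => 0 < Wn W n (c m') y)).card),
    Wn W n (c m) y

/-- The zero-undetected-error capacity of the channel `W` with input alphabet
`X ⊆ Y` (natural logarithms). -/
noncomputable def Ceo {Y : Type*} [Fintype Y] (X : Finset Y) (W : Y → Y → ℝ) : ℝ :=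
  sSup (insert 0 {R : ℝ | 0 ≤ R ∧ ∀ δ : ℝ, 0 < δ →
    ∃ (n M : ℕ) (c : Fin M → Fin n → Y), 1 ≤ n ∧ (∀ m j, c m j ∈ X) ∧
      Real.exp (n * R) ≤ (M : ℝ) ∧ ∀ m, erasureProb W c m < δ})

/-- The Sperner capacity of the channel `W` with input alphabet `X ⊆ Y`:
the supremum over blocklengths `n` and blocklength-`n` Sperner codes of
`(1/n) log M`. -/
noncomputable def Csp {Y : Type*} [Fintype Y] (X : Finset Y) (W : Y → Y → ℝ) : ℝ :=
  sSup {r : ℝ | ∃ (n M : ℕ) (c : Fin M → Fin n → Y), 1 ≤ n ∧ 1 ≤ M ∧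
    (∀ m j, c m j ∈ X) ∧ (∀ m m' : Fin M, m ≠ m' → Wn W n (c m') (c m) = 0) ∧
    r = Real.log M / n}

lemma aux_csp_bdd {Y : Type*} [Fintype Y] (X : Finset Y) (W : Y → Y → ℝ)
    (hd : ∀ x ∈ X, 0 < W x x) :
    BddAbove {r : ℝ | ∃ (n M : ℕ) (c : Fin M → Fin n → Y), 1 ≤ n ∧ 1 ≤ M ∧
    (∀ m j, c m j ∈ X) ∧ (∀ m m' : Fin M, m ≠ m' → Wn W n (c m') (c m) = 0) ∧
    r = Real.log M / n} := by
  refine ⟨Real.log (Fintype.card Y), ?_⟩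
  rintro r ⟨n, M, c, hn, hM, hcX, hsp, rfl⟩
  have hinj : Function.Injective c := by
    intro m m' h
    by_contra hne
    have h0 := hsp m m' hne
    rw [h] at h0
    have : 0 < Wn W n (c m') (c m') := Finset.prod_pos fun j _ => hd _ (hcX m' j)
    linarith
  have hcard := Fintype.card_le_of_injective c hinj
  simp only [Fintype.card_fin, Fintype.card_fun] at hcard
  have hn' : (0 : ℝ) < n := by exact_mod_cast hn
  rw [div_le_iff₀ hn', mul_comm, ← Real.log_pow]
  apply Real.log_le_log
  · exact_mod_cast hM
  · exact_mod_cast hcard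

lemma aux_csp_nonneg {Y : Type*} [Fintype Y] (X : Finset Y) (W : Y → Y → ℝ) :
    0 ≤ Csp X W := by
  apply Real.sSup_nonneg
  rintro r ⟨n, M, c, hn, hM, hcX, hsp, rfl⟩
  exact div_nonneg (Real.log_natCast_nonneg M) (Nat.cast_nonneg n)

lemma aux_sperner_card {Y : Type*} [Fintype Y] (X : Finset Y) (W : Y → Y → ℝ)
    (hd : ∀ x ∈ X, 0 < W x x) {ι J : Type*} [Fintype ι] [Fintype J] (c : ι → J → Y)
    (hcX : ∀ i j, c i j ∈ X) (hsp : ∀ i i', i ≠ i' → ∏ j, W (c i' j) (c i j) = 0) :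
    (Fintype.card ι : ℝ) ≤ Real.exp (Csp X W) ^ Fintype.card J := by
  rcases Nat.eq_zero_or_pos (Fintype.card J) with hJ | hJ
  · have : IsEmpty J := Fintype.card_eq_zero_iff.mp hJ
    have hs : Fintype.card ι ≤ 1 := by
      rw [Fintype.card_le_one_iff]
      intro a b
      by_contra hne
      have := hsp a b hne
      simp at this
    rw [hJ, pow_zero]
    exact_mod_cast hs
  rcases Nat.eq_zero_or_pos (Fintype.card ι) with hI | hI
  · rw [hI]; simp only [Nat.cast_zero]; positivity
  have key : Real.log (Fintype.card ι) / (Fintype.card J) ≤ Csp X W := by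
    apply le_csSup (aux_csp_bdd X W hd)
    refine ⟨Fintype.card J, Fintype.card ι,
      fun m j => c ((Fintype.equivFin ι).symm m) ((Fintype.equivFin J).symm j), hJ, hI, ?_, ?_, rfl⟩
    · intro m j; exact hcX _ _
    · intro m m' hne
      have := hsp ((Fintype.equivFin ι).symm m) ((Fintype.equivFin ι).symm m') (by simpa using hne)
      rw [← this]
      unfold Wn
      exact Equiv.prod_comp (Fintype.equivFin J).symm
        (fun j => W (c ((Fintype.equivFin ι).symm m') j) (c ((Fintype.equivFin ι).symm m) j))
  have hJ' : (0 : ℝ) < Fintype.card J := by exact_mod_cast hJ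
  have hI' : (0 : ℝ) < Fintype.card ι := by exact_mod_cast hI
  rw [div_le_iff₀ hJ'] at key
  rw [← Real.exp_nat_mul, ← Real.log_le_iff_le_exp hI']
  linarith

/-- Position-wise error pattern of an input and an output word. -/
noncomputable def auxPat {Y : Type*} {n : ℕ} (x y : Fin n → Y) : Fin n → Option (Y × Y) :=
  fun j => if x j = y j then none else some (x j, y j)

/-- Correctly decodable pairs of a message and an output word. -/
noncomputable def auxD {Y : Type*} [Fintype Y] (W : Y → Y → ℝ) {n M : ℕ}
    (c : Fin M → Fin n → Y) : Finset (Fin M × (Fin n → Y)) :=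
  Finset.univ.filter fun p => 0 < Wn W n (c p.1) p.2 ∧ ∀ m', 0 < Wn W n (c m') p.2 → m' = p.1

lemma aux_class_card {Y : Type*} [Fintype Y] (X : Finset Y) (W : Y → Y → ℝ)
    (hd : ∀ x ∈ X, 0 < W x x) (hW0 : ∀ x ∈ X, ∀ y, 0 ≤ W x y) {n M : ℕ}
    (c : Fin M → Fin n → Y) (hcX : ∀ m j, c m j ∈ X) (t : Fin n → Option (Y × Y)) :
    (((auxD W c).filter fun p => auxPat (c p.1) p.2 = t).card : ℝ) ≤
      ∏ j, (if t j = none then Real.exp (Csp X W) else 1) := by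
  have h := aux_sperner_card X W hd
    (ι := {p // p ∈ (auxD W c).filter fun p => auxPat (c p.1) p.2 = t})
    (J := {j // t j = none}) (fun p j => c p.1.1 j.1) (fun _ _ => hcX _ _) ?_
  · rw [Fintype.card_coe] at h
    refine h.trans (le_of_eq ?_)
    rw [Finset.prod_ite, Finset.prod_const, Finset.prod_const_one, mul_one, Fintype.card_subtype]
  · rintro ⟨⟨m, y⟩, hp⟩ ⟨⟨m', y'⟩, hp'⟩ hne
    by_contra h0
    apply hne
    simp only [auxD, Finset.mem_filter, Finset.mem_univ, true_and] at hp hp'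
    obtain ⟨⟨hpos, huniq⟩, hpat⟩ := hp
    obtain ⟨⟨hpos', huniq'⟩, hpat'⟩ := hp'
    simp only at h0
    replace h0 := Finset.prod_ne_zero_iff.mp h0
    have hm : m' = m := by
      apply huniq
      refine Finset.prod_pos fun j _ => lt_of_le_of_ne (hW0 _ (hcX _ _) _) (Ne.symm ?_)
      have h1 := congrFun hpat j
      have h2 := congrFun hpat' j
      simp only [auxPat] at h1 h2
      by_cases htj : t j = none
      · have h3 := h0 ⟨j, htj⟩ (Finset.mem_univ _)
        rw [htj] at h1
        have h4 : c m j = y j := by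
          by_contra h5; simp [h5] at h1
        rw [← h4]; exact h3
      · have h4 : c m j ≠ y j := by
          intro h5; rw [if_pos h5] at h1; exact htj h1.symm
        have h5 : c m' j ≠ y' j := by
          intro h5; rw [if_pos h5] at h2; exact htj h2.symm
        rw [if_neg h4] at h1
        rw [if_neg h5, ← h1] at h2
        simp only [Option.some.injEq, Prod.mk.injEq] at h2
        have h6 := Finset.prod_ne_zero_iff.mp hpos'.ne' j (Finset.mem_univ _)
        rw [← h2.2]; exact h6
    subst hm
    have hy : y = y' := by
      funext j
      have h1 := congrFun hpat j
      have h2 := congrFun hpat' j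
      rw [← h2] at h1
      simp only [auxPat] at h1
      split_ifs at h1 with h3 h4 h4
      · rw [← h3, ← h4]
      · simpa using h1
    subst hy
    rfl

lemma aux_sum_D_le {Y : Type*} [Fintype Y] (X : Finset Y) (W : Y → Y → ℝ)
    (hd : ∀ x ∈ X, 0 < W x x) (hW0 : ∀ x ∈ X, ∀ y, 0 ≤ W x y)
    (hW1 : ∀ x ∈ X, ∑ y, W x y = 1) {n M : ℕ}
    (c : Fin M → Fin n → Y) (hcX : ∀ m j, c m j ∈ X) :
    ∑ p ∈ auxD W c, Wn W n (c p.1) p.2 ≤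
      (Real.exp (Csp X W) + ∑ q : Y × Y, if q.1 ∈ X ∧ q.1 ≠ q.2 then W q.1 q.2 else 0) ^ n := by
  set g : Y × Y → ℝ := fun q => if q.1 ∈ X ∧ q.1 ≠ q.2 then W q.1 q.2 else 0 with hg
  have hg0 : ∀ q, 0 ≤ g q := by
    intro q; simp only [hg]; split_ifs with h
    · exact hW0 _ h.1 _
    · exact le_rfl
  have hW_le : ∀ x ∈ X, ∀ y, W x y ≤ 1 := by
    intro x hx y
    rw [← hW1 x hx]
    exact Finset.single_le_sum (f := fun y => W x y) (fun i _ => hW0 x hx i) (Finset.mem_univ y)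
  let v : Option (Y × Y) → ℝ := fun o => o.elim 1 g
  let w : Option (Y × Y) → ℝ := fun o => o.elim (Real.exp (Csp X W)) g
  have hv0 : ∀ o, 0 ≤ v o := by
    rintro (_ | q)
    · exact zero_le_one
    · exact hg0 q
  have hpw : ∀ p ∈ auxD W c, Wn W n (c p.1) p.2 ≤ ∏ j, v (auxPat (c p.1) p.2 j) := by
    intro p _
    refine Finset.prod_le_prod (fun j _ => hW0 _ (hcX _ _) _) fun j _ => ?_
    unfold auxPat
    split_ifs with h
    · exact hW_le _ (hcX _ _) _
    · simp only [v, Option.elim, hg]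
      rw [if_pos ⟨hcX _ _, h⟩]
  calc ∑ p ∈ auxD W c, Wn W n (c p.1) p.2
      ≤ ∑ p ∈ auxD W c, ∏ j, v (auxPat (c p.1) p.2 j) := Finset.sum_le_sum hpw
    _ = ∑ t : Fin n → Option (Y × Y), ∑ p ∈ (auxD W c).filter (fun p => auxPat (c p.1) p.2 = t),
          ∏ j, v (auxPat (c p.1) p.2 j) := (Finset.sum_fiberwise _ _ _).symm
    _ = ∑ t : Fin n → Option (Y × Y),
          (((auxD W c).filter fun p => auxPat (c p.1) p.2 = t).card : ℝ) * ∏ j, v (t j) := by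
        refine Finset.sum_congr rfl fun t _ => ?_
        rw [← nsmul_eq_mul]
        apply Finset.sum_eq_card_nsmul
        intro p hp
        rw [(Finset.mem_filter.mp hp).2]
    _ ≤ ∑ t : Fin n → Option (Y × Y), ∏ j, w (t j) := by
        refine Finset.sum_le_sum fun t _ => ?_
        refine (mul_le_mul_of_nonneg_right (aux_class_card X W hd hW0 c hcX t)
          (Finset.prod_nonneg fun j _ => hv0 _)).trans (le_of_eq ?_)
        rw [← Finset.prod_mul_distrib]
        refine Finset.prod_congr rfl fun j _ => ?_
        rcases t j with _ | q <;> simp [v, w]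
    _ = (∑ o, w o) ^ n := by
        rw [Fintype.sum_pow]
    _ = _ := by
        rw [Fintype.sum_option]; rfl

lemma aux_sum_Wn {Y : Type*} [Fintype Y] (X : Finset Y) (W : Y → Y → ℝ)
    (hW1 : ∀ x ∈ X, ∑ y, W x y = 1) {n : ℕ} (x : Fin n → Y) (hx : ∀ j, x j ∈ X) :
    ∑ y, Wn W n x y = 1 := by
  unfold Wn
  rw [← Fintype.prod_sum (fun j y => W (x j) y)]
  exact Finset.prod_eq_one fun j _ => hW1 _ (hx j)

lemma aux_sum_D_ge {Y : Type*} [Fintype Y] (X : Finset Y) (W : Y → Y → ℝ)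
    (hW0 : ∀ x ∈ X, ∀ y, 0 ≤ W x y)
    (hW1 : ∀ x ∈ X, ∑ y, W x y = 1) {n M : ℕ}
    (c : Fin M → Fin n → Y) (hcX : ∀ m j, c m j ∈ X) (δ : ℝ)
    (hδ : ∀ m, erasureProb W c m < δ) :
    (M : ℝ) * (1 - δ) ≤ ∑ p ∈ auxD W c, Wn W n (c p.1) p.2 := by
  unfold auxD
  rw [Finset.sum_filter, Fintype.sum_prod_type]
  have : (M : ℝ) * (1 - δ) = ∑ _m : Fin M, (1 - δ) := by
    rw [Finset.sum_const, Finset.card_univ, Fintype.card_fin, nsmul_eq_mul]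
  rw [this]
  refine Finset.sum_le_sum fun m _ => ?_
  have h1 := aux_sum_Wn X W hW1 (c m) (hcX m)
  have h2 := hδ m
  unfold erasureProb at h2
  rw [← Finset.sum_filter_add_sum_filter_not Finset.univ (fun y : Fin n → Y =>
      1 < (Finset.univ.filter (fun m' : Fin M => 0 < Wn W n (c m') y)).card)] at h1
  have h3 : ∑ y ∈ Finset.univ.filter (fun y : Fin n → Y =>
      ¬ 1 < (Finset.univ.filter (fun m' : Fin M => 0 < Wn W n (c m') y)).card), Wn W n (c m) y
      ≤ ∑ y, if 0 < Wn W n (c m) y ∧ ∀ m', 0 < Wn W n (c m') y → m' = m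
        then Wn W n (c m) y else 0 := by
    rw [Finset.sum_filter]
    refine Finset.sum_le_sum fun y _ => ?_
    have hnn : 0 ≤ Wn W n (c m) y := Finset.prod_nonneg fun j _ => hW0 _ (hcX _ _) _
    by_cases hp : 0 < Wn W n (c m) y
    · by_cases hc : 1 < (Finset.univ.filter (fun m' : Fin M => 0 < Wn W n (c m') y)).card
      · rw [if_neg (not_not.mpr hc)]
        split_ifs
        · exact hnn
        · exact le_rfl
      · rw [if_pos hc, if_pos]
        refine ⟨hp, fun m' hm' => ?_⟩
        exact Finset.card_le_one.mp (not_lt.mp hc) m' (by simpa using hm') m (by simpa using hp)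
    · have h0 : Wn W n (c m) y = 0 := le_antisymm (not_lt.mp hp) hnn
      simp [h0]
  simp only at h3 ⊢
  linarith

lemma aux_g_le {Y : Type*} [Fintype Y] (X : Finset Y) (W : Y → Y → ℝ) (ε : ℝ)
    (hW0 : ∀ x ∈ X, ∀ y, 0 ≤ W x y)
    (hW1 : ∀ x ∈ X, ∑ y, W x y = 1)
    (hnoise : ∀ x ∈ X, 1 - ε ≤ W x x) :
    (∑ q : Y × Y, if q.1 ∈ X ∧ q.1 ≠ q.2 then W q.1 q.2 else 0)
      ≤ ε * X.card * (Fintype.card Y - 1) := by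
  have hoff : ∀ x ∈ X, ∀ y, x ≠ y → W x y ≤ ε := by
    intro x hx y hne
    have h1 := hW1 x hx
    have h2 : W x x + W x y ≤ ∑ z, W x z := by
      rw [← Finset.sum_pair (f := fun z => W x z) hne]
      exact Finset.sum_le_sum_of_subset_of_nonneg (Finset.subset_univ _)
        fun i _ _ => hW0 x hx i
    have := hnoise x hx
    linarith
  rw [Fintype.sum_prod_type]
  have : ∀ x : Y, (∑ y, if x ∈ X ∧ x ≠ y then W x y else 0)
      ≤ if x ∈ X then ε * (Fintype.card Y - 1) else 0 := by
    intro x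
    by_cases hx : x ∈ X
    · simp only [hx, true_and, if_true]
      rw [← Finset.sum_filter]
      refine (Finset.sum_le_card_nsmul _ _ ε fun y hy =>
        hoff x hx y (Finset.mem_filter.mp hy).2).trans (le_of_eq ?_)
      rw [Finset.filter_ne, Finset.card_erase_of_mem (Finset.mem_univ _), nsmul_eq_mul,
        Finset.card_univ, Nat.cast_sub (Fintype.card_pos_iff.mpr ⟨x⟩)]
      push_cast; ring
    · simp [hx]
  refine (Finset.sum_le_sum fun x _ => this x).trans (le_of_eq ?_)
  rw [← Finset.sum_filter, Finset.sum_const, nsmul_eq_mul]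
  simp only [Finset.filter_mem_eq_inter, Finset.univ_inter]
  ring

/-- For every `ε`-noise channel, `C_eo ≤ log (e^{C_sp} + ε |X| (|Y|-1))`. -/
theorem zue_capacity_le_log_exp_sperner {Y : Type*} [Fintype Y] (X : Finset Y)
    (hX : X.Nonempty) (W : Y → Y → ℝ) (ε : ℝ) (hε0 : 0 ≤ ε) (hε1 : ε < 1)
    (hW0 : ∀ x ∈ X, ∀ y, 0 ≤ W x y)
    (hW1 : ∀ x ∈ X, ∑ y, W x y = 1)
    (hnoise : ∀ x ∈ X, 1 - ε ≤ W x x) :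
    Ceo X W ≤ Real.log (Real.exp (Csp X W) + ε * X.card * (Fintype.card Y - 1)) := by
  have hd : ∀ x ∈ X, 0 < W x x := fun x hx => by linarith [hnoise x hx]
  have hC := aux_csp_nonneg X W
  have hg := aux_g_le X W ε hW0 hW1 hnoise
  have hg0 : 0 ≤ ∑ q : Y × Y, if q.1 ∈ X ∧ q.1 ≠ q.2 then W q.1 q.2 else 0 := by
    refine Finset.sum_nonneg fun q _ => ?_
    split_ifs with h
    · exact hW0 _ h.1 _
    · exact le_rfl
  have he := Real.one_le_exp hC
  set A := Real.exp (Csp X W) + ε * X.card * (Fintype.card Y - 1) with hA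
  have hA1 : 1 ≤ A := by linarith
  have hA0 : 0 < A := by linarith
  apply csSup_le (Set.insert_nonempty _ _)
  rintro R (rfl | ⟨hR0, hR⟩)
  · exact Real.log_nonneg hA1
  rw [Real.le_log_iff_exp_le hA0]
  by_contra hlt
  push Not at hlt
  have hδ : 0 < 1 - A / Real.exp R := by
    rw [sub_pos, div_lt_one (Real.exp_pos R)]; exact hlt
  obtain ⟨n, M, c, hn, hcX, hM, her⟩ := hR ((1 - A / Real.exp R) / 2) (by linarith)
  have h1 := aux_sum_D_ge X W hW0 hW1 c hcX _ her
  have h2 := aux_sum_D_le X W hd hW0 hW1 c hcX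
  have hle : (Real.exp (Csp X W) + ∑ q : Y × Y, if q.1 ∈ X ∧ q.1 ≠ q.2 then W q.1 q.2 else 0) ≤ A := by
    linarith
  have h3 := pow_le_pow_left₀ (by linarith) hle n
  set r := A / Real.exp R with hr
  have hr0 : 0 < r := by positivity
  have h4 : A ^ n = r ^ n * Real.exp (n * R) := by
    rw [Real.exp_nat_mul, ← mul_pow, hr, div_mul_cancel₀ _ (Real.exp_pos R).ne']
  have h5 : r ^ n ≤ r := pow_le_of_le_one hr0.le (by linarith) (by omega)
  have h6 := Real.exp_pos (n * R)
  have h7 : Real.exp (n * R) * (1 - (1 - r) / 2) ≤ M * (1 - (1 - r) / 2) :=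
    mul_le_mul_of_nonneg_right hM (by linarith)
  have h8 : Real.exp (n * R) * (1 - (1 - r) / 2) ≤ Real.exp (n * R) * r := by
    calc _ ≤ A ^ n := by linarith
      _ = Real.exp (n * R) * r ^ n := by rw [h4]; ring
      _ ≤ _ := mul_le_mul_of_nonneg_left h5 h6.le
  have h9 := le_of_mul_le_mul_left h8 h6
  linarith
end

section
/- Fix finite alphabets X ⊆ Y and a set S ⊆ X×Y containing (x,x) for every x ∈ X. The Sperner capacity of a DMC depends only on the support of its transition law; denote by C_sp(S) the common Sperner capacity of all channels W with supp(W) = S. Then the z.u.e. capacity tends to C_sp(S) uniformly as the noise vanishes: for every δ > 0 there exists ε₀ ∈ (0,1) such that for every ε < ε₀ and every ε-noise channel W with supp(W) = S one has |C_eo(W) − C_sp(S)| ≤ δ. -/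
open scoped Classical
open Real Finset

/-- The Sperner capacity associated with a support set `S ⊆ X × Y`: the common
Sperner capacity of all channels whose transition law has support `S`.  A
Sperner code is a codebook such that for any two distinct messages `m ≠ m'`
there is a coordinate `j` with `(x_{m'}^{(j)}, x_m^{(j)}) ∉ S`. -/
noncomputable def CspSupp {Y : Type*} [Fintype Y] (X : Finset Y) (S : Finset (Y × Y)) : ℝ :=
  sSup {r : ℝ | ∃ (n M : ℕ) (c : Fin M → Fin n → Y), 1 ≤ n ∧ 1 ≤ M ∧
    (∀ m j, c m j ∈ X) ∧ (∀ m m' : Fin M, m ≠ m' → ∃ j, (c m' j, c m j) ∉ S) ∧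
    r = Real.log M / n}

/-- Hamming distance, as a real number. -/
noncomputable def nd {N : ℕ} {K : Type*} (w g : Fin N → K) : ℝ :=
  ((Finset.univ.filter fun i => w i ≠ g i).card : ℝ)

lemma prod_ite_exp {N : ℕ} {K : Type*} (a : ℝ) (w g : Fin N → K) :
    ∏ i, (if w i ≠ g i then Real.exp a else 1)
      = Real.exp (a * nd (w) (g)) := by
  rw [Finset.prod_ite, nd]
  simp only [Finset.prod_const, one_pow, mul_one]
  rw [← Real.exp_nat_mul]
  congr 1
  ring

lemma chernoff {N : ℕ} {K : Type*} [Fintype K] (p : Fin N → K → ℝ) (g : Fin N → K)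
    (hp : ∀ i k, 0 ≤ p i k) (hs : ∀ i, ∑ k, p i k = 1) (ε τ : ℝ) (hε : 0 ≤ ε)
    (hg : ∀ i, 1 - ε ≤ p i (g i)) (hτ : 4 * ε ≤ τ) :
    ∑ y ∈ Finset.univ.filter (fun y : Fin N → K =>
        τ * N < nd (y) (g)), ∏ i, p i (y i)
      ≤ Real.exp (-(τ * N / 2)) := by
  have hfac : ∀ i, ∑ k, p i k * (if k ≠ g i then Real.exp 1 else 1) ≤ Real.exp (τ / 2) := by
    intro i
    have h1 : ∀ k, p i k * (if k ≠ g i then Real.exp 1 else 1)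
        = Real.exp 1 * p i k - (if k = g i then (Real.exp 1 - 1) * p i k else 0) := by
      intro k
      by_cases h : k = g i
      · simp [h]; ring
      · simp [h, mul_comm]
    simp_rw [h1]
    rw [Finset.sum_sub_distrib, ← Finset.mul_sum, hs, Finset.sum_ite_eq']
    simp only [Finset.mem_univ, if_true]
    have he : Real.exp 1 < 3 := by have := Real.exp_one_lt_d9; linarith
    have he1 : 2 < Real.exp 1 := by have := Real.exp_one_gt_d9; linarith
    have h2 := Real.add_one_le_exp (τ / 2)
    nlinarith [hg i]
  calc _ ≤ ∑ y ∈ Finset.univ.filter (fun y : Fin N → K =>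
        τ * N < nd (y) (g)),
          Real.exp (-(τ * N)) * ∏ i, (p i (y i) * (if y i ≠ g i then Real.exp 1 else 1)) := by
        refine Finset.sum_le_sum fun y hy => ?_
        rw [Finset.prod_mul_distrib, prod_ite_exp, mul_comm, mul_assoc, ← Real.exp_add]
        have h0 : 0 ≤ ∏ i, p i (y i) := Finset.prod_nonneg fun i _ => hp i _
        have h1 := (Finset.mem_filter.1 hy).2
        refine le_mul_of_one_le_right h0 (Real.one_le_exp ?_)
        linarith
    _ ≤ ∑ y : Fin N → K,
          Real.exp (-(τ * N)) * ∏ i, (p i (y i) * (if y i ≠ g i then Real.exp 1 else 1)) := by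
        refine Finset.sum_le_sum_of_subset_of_nonneg (Finset.subset_univ _) fun y _ _ => ?_
        refine mul_nonneg (Real.exp_pos _).le (Finset.prod_nonneg fun i _ => mul_nonneg (hp i _) ?_)
        split_ifs <;> positivity
    _ = Real.exp (-(τ * N)) * ∏ i, ∑ k, (p i k * (if k ≠ g i then Real.exp 1 else 1)) := by
        rw [← Finset.mul_sum, Finset.prod_univ_sum, Fintype.piFinset_univ]
    _ ≤ Real.exp (-(τ * N)) * ∏ _i : Fin N, Real.exp (τ / 2) := by
        refine mul_le_mul_of_nonneg_left ?_ (Real.exp_pos _).le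
        refine Finset.prod_le_prod (fun i _ => Finset.sum_nonneg fun k _ => mul_nonneg (hp i _) ?_)
          fun i _ => hfac i
        split_ifs <;> positivity
    _ = _ := by
        rw [Finset.prod_const, Finset.card_univ, Fintype.card_fin, ← Real.exp_nat_mul, ← Real.exp_add]
        congr 1; ring

lemma ball_bound (K : Type*) [Fintype K] (η : ℝ) (hη : 0 < η) :
    ∃ τ : ℝ, 0 < τ ∧ τ < 1 ∧ ∀ (N : ℕ) (g : Fin N → K),
      ((Finset.univ.filter fun w : Fin N → K =>
        nd (w) (g) ≤ τ * N).card : ℝ)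
        ≤ Real.exp (η * N) := by
  obtain ⟨a, ha, hb⟩ : ∃ a : ℝ, 0 < a ∧ (Fintype.card K : ℝ) * Real.exp (-a) ≤ η / 2 := by
    have h : Filter.Tendsto (fun a : ℝ => (Fintype.card K : ℝ) * Real.exp (-a)) Filter.atTop
        (nhds ((Fintype.card K : ℝ) * 0)) :=
      (Real.tendsto_exp_neg_atTop_nhds_zero).const_mul _
    rw [mul_zero] at h
    obtain ⟨a, h1, h2⟩ := ((Filter.eventually_gt_atTop (0:ℝ)).and
      (h.eventually_le_const (by positivity : (0:ℝ) < η / 2))).exists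
    exact ⟨a, h1, h2⟩
  refine ⟨min (1 / 2) (η / (2 * a)), by positivity,
    lt_of_le_of_lt (min_le_left _ _) (by norm_num), ?_⟩
  intro N g
  set τ := min (1 / 2) (η / (2 * a)) with hτ
  have hτa : a * τ ≤ η / 2 := by
    have : τ ≤ η / (2 * a) := min_le_right _ _
    calc a * τ ≤ a * (η / (2 * a)) := by gcongr
      _ = η / 2 := by field_simp
  set B := Finset.univ.filter fun w : Fin N → K =>
        nd (w) (g) ≤ τ * N with hB
  have key : (B.card : ℝ) * Real.exp (-a * (τ * N)) ≤ Real.exp (η / 2 * N) := by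
    calc (B.card : ℝ) * Real.exp (-a * (τ * N)) = ∑ _w ∈ B, Real.exp (-a * (τ * N)) := by
          rw [Finset.sum_const, nsmul_eq_mul]
      _ ≤ ∑ w ∈ B, ∏ i, (if w i ≠ g i then Real.exp (-a) else 1) := by
          refine Finset.sum_le_sum fun w hw => ?_
          rw [prod_ite_exp]
          have h1 := (Finset.mem_filter.1 hw).2
          refine Real.exp_le_exp.2 ?_
          nlinarith
      _ ≤ ∑ w : Fin N → K, ∏ i, (if w i ≠ g i then Real.exp (-a) else 1) := by
          refine Finset.sum_le_sum_of_subset_of_nonneg (Finset.subset_univ _) fun y _ _ => ?_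
          refine Finset.prod_nonneg fun i _ => ?_
          split_ifs <;> positivity
      _ = ∏ i, ∑ k, (if k ≠ g i then Real.exp (-a) else 1) := by
          rw [Finset.prod_univ_sum, Fintype.piFinset_univ]
      _ ≤ ∏ _i : Fin N, Real.exp (η / 2) := by
          refine Finset.prod_le_prod (fun i _ => Finset.sum_nonneg fun k _ => ?_) fun i _ => ?_
          · split_ifs <;> positivity
          · calc ∑ k, (if k ≠ g i then Real.exp (-a) else 1)
                ≤ ∑ k, (Real.exp (-a) + if k = g i then 1 else 0) := by
                  refine Finset.sum_le_sum fun k _ => ?_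
                  by_cases h : k = g i
                  · simp [h]; positivity
                  · simp [h]
              _ = Fintype.card K * Real.exp (-a) + 1 := by
                  rw [Finset.sum_add_distrib, Finset.sum_ite_eq']
                  simp
              _ ≤ η / 2 + 1 := by linarith
              _ ≤ _ := Real.add_one_le_exp _
      _ = _ := by
          rw [Finset.prod_const, Finset.card_univ, Fintype.card_fin, ← Real.exp_nat_mul]
          congr 1; ring
  have h3 : (B.card : ℝ) = (B.card : ℝ) * Real.exp (-a * (τ * N)) * Real.exp (a * (τ * N)) := by
    rw [mul_assoc, ← Real.exp_add]; simp
  rw [h3]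
  calc _ ≤ Real.exp (η / 2 * N) * Real.exp (a * (τ * N)) := by gcongr
    _ = Real.exp (η / 2 * N + a * τ * N) := by rw [← Real.exp_add]; congr 1; ring
    _ ≤ _ := by
      refine Real.exp_le_exp.2 ?_
      have : a * τ * N ≤ η / 2 * N := by gcongr
      linarith

/-- Gilbert-Varshamov. -/
lemma gv (K : Type*) [Fintype K] (N : ℕ) (τ V : ℝ)
    (hτ : 0 ≤ τ)
    (hV : ∀ g : Fin N → K, ((Finset.univ.filter fun w : Fin N → K =>
        nd (w) (g) ≤ τ * N).card : ℝ) ≤ V) :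
    ∃ C : Finset (Fin N → K), (∀ w ∈ C, ∀ g ∈ C, w ≠ g →
        τ * N < nd (w) (g)) ∧
      (Fintype.card K : ℝ) ^ N ≤ C.card * V := by
  set P : Finset (Fin N → K) → Prop := fun C => ∀ w ∈ C, ∀ g ∈ C, w ≠ g →
        τ * N < nd (w) (g) with hP
  obtain ⟨C, hC, hmax⟩ := Finset.exists_max_image (Finset.univ.filter P) Finset.card
    ⟨∅, by simp [hP]⟩
  have hC' : P C := (Finset.mem_filter.1 hC).2
  refine ⟨C, hC', ?_⟩
  have hcov : (Finset.univ : Finset (Fin N → K)) ⊆ C.biUnion fun g =>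
      Finset.univ.filter fun w : Fin N → K =>
        nd (w) (g) ≤ τ * N := by
    intro w _
    by_contra hw
    simp only [Finset.mem_biUnion, Finset.mem_filter, Finset.mem_univ, true_and, not_exists,
      not_and, not_le] at hw
    have hwC : w ∉ C := by
      intro h
      have := hw w h
      simp [nd] at this
      have : 0 ≤ τ * N := by positivity
      linarith
    have hins : P (insert w C) := by
      intro u hu v hv huv
      rcases Finset.mem_insert.1 hu with rfl | hu'
      · rcases Finset.mem_insert.1 hv with rfl | hv
        · exact absurd rfl huv
        · exact hw v hv
      · rcases Finset.mem_insert.1 hv with rfl | hv'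
        · have := hw u hu'
          simpa only [nd, ne_comm] using this
        · exact hC' u hu' v hv' huv
    have := hmax (insert w C) (Finset.mem_filter.2 ⟨Finset.mem_univ _, hins⟩)
    rw [Finset.card_insert_of_notMem hwC] at this
    omega
  have h1 := Finset.card_le_card hcov
  have h2 := h1.trans Finset.card_biUnion_le
  have h3 : (Fintype.card K : ℝ) ^ N = ((Finset.univ : Finset (Fin N → K)).card : ℝ) := by
    rw [Finset.card_univ, Fintype.card_fun]; simp
  rw [h3]
  calc _ ≤ ((∑ g ∈ C, (Finset.univ.filter fun w : Fin N → K =>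
        nd (w) (g) ≤ τ * N).card : ℕ) : ℝ) := by
        exact_mod_cast h2
    _ ≤ ∑ _g ∈ C, V := by
        push_cast
        exact Finset.sum_le_sum fun g _ => hV g
    _ = _ := by rw [Finset.sum_const, nsmul_eq_mul]

lemma csp_bdd {Y : Type*} [Fintype Y] (X : Finset Y) (hX : X.Nonempty) (S : Finset (Y × Y))
    (hdiag : ∀ x ∈ X, (x, x) ∈ S) :
    BddAbove {r : ℝ | ∃ (n M : ℕ) (c : Fin M → Fin n → Y), 1 ≤ n ∧ 1 ≤ M ∧
    (∀ m j, c m j ∈ X) ∧ (∀ m m' : Fin M, m ≠ m' → ∃ j, (c m' j, c m j) ∉ S) ∧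
    r = Real.log M / n} := by
  refine ⟨Real.log (Fintype.card Y), ?_⟩
  rintro r ⟨n, M, c, hn, hM, hc, hs, rfl⟩
  have hinj : Function.Injective c := by
    intro m m' h
    by_contra hne
    obtain ⟨j, hj⟩ := hs m m' hne
    rw [h] at hj
    exact hj (hdiag _ (hc _ _))
  have h1 := Fintype.card_le_of_injective c hinj
  rw [Fintype.card_fun, Fintype.card_fin, Fintype.card_fin] at h1
  have hM' : (0:ℝ) < M := by exact_mod_cast hM
  have hn' : (0:ℝ) < n := by exact_mod_cast hn
  rw [div_le_iff₀ hn']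
  have h2 : (M : ℝ) ≤ (Fintype.card Y : ℝ) ^ n := by exact_mod_cast h1
  have h3 := Real.log_le_log hM' h2
  rw [Real.log_pow] at h3
  linarith

lemma csp_mem_zero {Y : Type*} (X : Finset Y) (hX : X.Nonempty) (S : Finset (Y × Y)) :
    ∃ (n M : ℕ) (c : Fin M → Fin n → Y), 1 ≤ n ∧ 1 ≤ M ∧
    (∀ m j, c m j ∈ X) ∧ (∀ m m' : Fin M, m ≠ m' → ∃ j, (c m' j, c m j) ∉ S) ∧
    (0:ℝ) = Real.log M / n := by
  obtain ⟨x, hx⟩ := hX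
  refine ⟨1, 1, fun _ _ => x, le_rfl, le_rfl, fun _ _ => hx, ?_, by simp⟩
  intro m m' h
  exact absurd (Subsingleton.elim m m') h

lemma sum_Wn {Y : Type*} [Fintype Y] (W : Y → Y → ℝ) (n : ℕ) (x : Fin n → Y)
    (h : ∀ j, ∑ y, W (x j) y = 1) : ∑ y, Wn W n x y = 1 := by
  unfold Wn
  have := Finset.prod_univ_sum (fun _ : Fin n => (Finset.univ : Finset Y)) (fun j y => W (x j) y)
  rw [Fintype.piFinset_univ] at this
  rw [← this]
  simp [h]

lemma Wn_pos_iff {Y : Type*} (W : Y → Y → ℝ) (n : ℕ) (x y : Fin n → Y)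
    (h : ∀ j, 0 ≤ W (x j) (y j)) : 0 < Wn W n x y ↔ ∀ j, 0 < W (x j) (y j) := by
  unfold Wn
  constructor
  · intro hp j
    refine lt_of_le_of_ne (h j) fun h0 => ?_
    rw [Finset.prod_eq_zero (Finset.mem_univ j) h0.symm] at hp
    exact lt_irrefl _ hp
  · intro hp
    exact Finset.prod_pos fun j _ => hp j

/-- The converse part. -/
lemma upper {Y : Type*} [Fintype Y] (X : Finset Y)
    (hX : X.Nonempty) (S : Finset (Y × Y)) (hdiag : ∀ x ∈ X, (x, x) ∈ S) (δ : ℝ) (hδ : 0 < δ) :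
    ∃ ε₀ : ℝ, 0 < ε₀ ∧ ∀ ε : ℝ, 0 ≤ ε → ε < ε₀ → ∀ W : Y → Y → ℝ,
          (∀ x ∈ X, ∀ y, 0 ≤ W x y) →
          (∀ x ∈ X, ∑ y, W x y = 1) →
          (∀ x ∈ X, 1 - ε ≤ W x x) →
          (∀ x ∈ X, ∀ y, (0 < W x y ↔ (x, y) ∈ S)) →
     ∀ R ∈ (insert 0 {R : ℝ | 0 ≤ R ∧ ∀ δ : ℝ, 0 < δ →
    ∃ (n M : ℕ) (c : Fin M → Fin n → Y), 1 ≤ n ∧ (∀ m j, c m j ∈ X) ∧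
      Real.exp (n * R) ≤ (M : ℝ) ∧ ∀ m, erasureProb W c m < δ}), R ≤ CspSupp X S + δ := by
  obtain ⟨τ, hτ0, hτ1, hball⟩ := ball_bound (Option Y) δ hδ
  refine ⟨τ / 4, by positivity, ?_⟩
  intro ε hε hε0 W hW0 hW1 hWε hWS R hR
  have hbdd := csp_bdd X hX S hdiag
  have hcsp0 : 0 ≤ CspSupp X S := le_csSup hbdd (csp_mem_zero X hX S)
  rcases hR with rfl | ⟨hR0, hR⟩
  · linarith
  obtain ⟨n, M, c, hn, hc, hM, her⟩ := hR (1 - Real.exp (-(τ / 2)))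
    (by have : Real.exp (-(τ / 2)) < 1 := by rw [← Real.exp_zero]; exact Real.exp_lt_exp.2 (by linarith)
        linarith)
  have hn' : (1:ℝ) ≤ n := by exact_mod_cast hn
  have hex : ∀ m, ∃ y : Fin n → Y, 0 < Wn W n (c m) y ∧
      nd (y) (c m) ≤ τ * n ∧
      ∀ m', 0 < Wn W n (c m') y → m' = m := by
    intro m
    by_contra hcon
    push Not at hcon
    have hch := chernoff (fun j => W (c m j)) (c m) (fun j k => hW0 _ (hc m j) k)
      (fun j => hW1 _ (hc m j)) ε τ hε (fun j => hWε _ (hc m j)) (by linarith)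
    have hsum := sum_Wn W n (c m) fun j => hW1 _ (hc m j)
    have hnn : ∀ y, 0 ≤ Wn W n (c m) y := fun y => Finset.prod_nonneg fun j _ => hW0 _ (hc m j) _
    have hle : ∑ y, Wn W n (c m) y ≤ erasureProb W c m + 
      ∑ y ∈ Finset.univ.filter (fun y : Fin n → Y =>
        τ * n < nd (y) (c m)), Wn W n (c m) y := by
      unfold erasureProb
      rw [Finset.sum_filter, Finset.sum_filter, ← Finset.sum_add_distrib]
      refine Finset.sum_le_sum fun y _ => ?_
      by_cases h0 : 0 < Wn W n (c m) y
      · by_cases h1 : nd (y) (c m) ≤ τ * n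
        · obtain ⟨m', hm', hne⟩ := hcon y h0 h1
          rw [if_pos]
          · have := hnn y
            split_ifs <;> linarith
          · rw [Finset.one_lt_card]
            exact ⟨m', by simpa using hm', m, by simpa using h0, hne⟩
        · have := hnn y
          rw [if_pos (not_le.1 h1)]
          split_ifs <;> linarith
      · have h1 : Wn W n (c m) y = 0 := le_antisymm (not_lt.1 h0) (hnn y)
        simp [h1]
    have h5 : Real.exp (-(τ * n / 2)) ≤ Real.exp (-(τ / 2)) := by
      refine Real.exp_le_exp.2 ?_
      nlinarith
    have h6 := her m
    have h7 : ∑ y ∈ Finset.univ.filter (fun y : Fin n → Y =>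
        τ * n < nd (y) (c m)), Wn W n (c m) y
        ≤ Real.exp (-(τ * n / 2)) := hch
    linarith
  choose y hy1 hy2 hy3 using hex
  set F : Fin M → Fin n → Option Y := fun m j => if y m j = c m j then none else some (y m j)
    with hF
  set B := Finset.univ.filter fun w : Fin n → Option Y =>
        nd (w) ((fun _ => none : Fin n → Option Y)) ≤ τ * n
        with hB
  have hBc : (B.card : ℝ) ≤ Real.exp (δ * n) := hball n _
  have hFB : ∀ m ∈ (Finset.univ : Finset (Fin M)), F m ∈ B := by
    intro m _
    refine Finset.mem_filter.2 ⟨Finset.mem_univ _, ?_⟩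
    have : nd (F m) (fun _ => none) = nd (y m) (c m) := by
      unfold nd
      congr 2
      ext i
      simp [hF]
    rw [this]
    exact hy2 m
  have hMpos : (0:ℝ) < M := lt_of_lt_of_le (Real.exp_pos _) hM
  have hBne : B.Nonempty := by
    have : 0 < M := by exact_mod_cast hMpos
    exact ⟨_, hFB ⟨0, this⟩ (Finset.mem_univ _)⟩
  obtain ⟨w, hw, hcard⟩ := Finset.exists_le_card_fiber_of_nsmul_le_card_of_maps_to hFB hBne
    (b := Real.exp (n * (R - δ))) (by
      rw [nsmul_eq_mul, Finset.card_univ, Fintype.card_fin]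
      calc _ ≤ Real.exp (δ * n) * Real.exp (n * (R - δ)) := by gcongr
        _ = Real.exp (n * R) := by rw [← Real.exp_add]; congr 1; ring
        _ ≤ _ := hM)
  set D := Finset.univ.filter fun m => F m = w with hD
  have hDpos : (0:ℝ) < D.card := lt_of_lt_of_le (Real.exp_pos _) hcard
  have hmem : Real.log D.card / n ≤ CspSupp X S := by
    refine le_csSup hbdd ⟨n, D.card, fun i => c (D.equivFin.symm i), hn, ?_, fun m j => hc _ _, ?_,
      rfl⟩
    · exact_mod_cast hDpos
    intro i i' hne
    set m : Fin M := (D.equivFin.symm i : Fin M) with hm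
    set m' : Fin M := (D.equivFin.symm i' : Fin M) with hm'
    have hmm : m' ≠ m := by
      intro h
      exact hne (D.equivFin.symm.injective (Subtype.ext h.symm))
    have hFm : F m = w := (Finset.mem_filter.1 (D.equivFin.symm i).2).2
    have hFm' : F m' = w := (Finset.mem_filter.1 (D.equivFin.symm i').2).2
    have hz : ¬ 0 < Wn W n (c m') (y m) := fun h => hmm (hy3 m m' h)
    rw [Wn_pos_iff W n _ _ fun j => hW0 _ (hc m' j) _] at hz
    push Not at hz
    obtain ⟨j, hj⟩ := hz
    refine ⟨j, ?_⟩
    by_cases hyc : y m j = c m j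
    · rw [hyc] at hj
      rw [← hWS _ (hc m' j)]
      exact not_lt.2 hj
    · exfalso
      have h1 : F m' j = F m j := by rw [hFm, hFm']
      simp only [hF, if_neg hyc] at h1
      split_ifs at h1 with h2
      have h3 : y m' j = y m j := Option.some.inj h1
      have h4 := (Wn_pos_iff W n (c m') (y m') fun j => hW0 _ (hc m' j) _).1 (hy1 m') j
      rw [h3] at h4
      linarith
  have hlog : n * (R - δ) ≤ Real.log D.card := (Real.le_log_iff_exp_le hDpos).2 hcard
  have : R - δ ≤ Real.log D.card / n := by
    rw [le_div_iff₀ (by linarith)]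
    linarith
  linarith

/-- Splitting a word of length `N * n` into `N` blocks of length `n`. -/
def blk (N n : ℕ) (Y : Type*) : (Fin (N * n) → Y) ≃ (Fin N → Fin n → Y) :=
  (Equiv.arrowCongr finProdFinEquiv.symm (Equiv.refl Y)).trans (Equiv.curry _ _ _)

lemma Wn_blk {Y : Type*} (W : Y → Y → ℝ) (N n : ℕ) (x y : Fin N → Fin n → Y) :
    Wn W (N * n) ((blk N n Y).symm x) ((blk N n Y).symm y) = ∏ i, Wn W n (x i) (y i) := by
  unfold Wn
  rw [← Fintype.prod_prod_type', ← finProdFinEquiv.prod_comp]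
  refine Finset.prod_congr rfl fun p _ => ?_
  simp [blk, Function.uncurry]

lemma lower {Y : Type*} [Fintype Y] (X : Finset Y)
    (S : Finset (Y × Y)) (n M : ℕ) (c : Fin M → Fin n → Y) (hn : 1 ≤ n) (hM : 1 ≤ M)
    (hc : ∀ m j, c m j ∈ X) (hs : ∀ m m' : Fin M, m ≠ m' → ∃ j, (c m' j, c m j) ∉ S)
    (δ : ℝ) (hδ : 0 < δ) :
    ∃ ε₀ : ℝ, 0 < ε₀ ∧ ∀ ε : ℝ, 0 ≤ ε → ε < ε₀ → ∀ W : Y → Y → ℝ,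
          (∀ x ∈ X, ∀ y, 0 ≤ W x y) →
          (∀ x ∈ X, ∑ y, W x y = 1) →
          (∀ x ∈ X, 1 - ε ≤ W x x) →
          (∀ x ∈ X, ∀ y, (0 < W x y ↔ (x, y) ∈ S)) →
     ∀ δ' : ℝ, 0 < δ' →
    ∃ (n' M' : ℕ) (c' : Fin M' → Fin n' → Y), 1 ≤ n' ∧ (∀ m j, c' m j ∈ X) ∧
      Real.exp (n' * (Real.log M / n - δ)) ≤ (M' : ℝ) ∧ ∀ m, erasureProb W c' m < δ' := by
  have hn' : (1:ℝ) ≤ n := by exact_mod_cast hn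
  have hM' : (1:ℝ) ≤ M := by exact_mod_cast hM
  obtain ⟨τ, hτ0, hτ1, hball⟩ := ball_bound (Fin M) (δ * n) (by positivity)
  refine ⟨τ / (4 * n), by positivity, ?_⟩
  intro ε hε hε0 W hW0 hW1 hWε hWS δ' hδ'
  rw [lt_div_iff₀ (by positivity)] at hε0
  obtain ⟨N, hN1, hN⟩ : ∃ N : ℕ, 1 ≤ N ∧ Real.exp (-(τ * N / 2)) < δ' := by
    have h : Filter.Tendsto (fun N : ℕ => Real.exp (-((τ / 2) * N))) Filter.atTop (nhds 0) := by
      refine Real.tendsto_exp_neg_atTop_nhds_zero.comp ?_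
      exact (tendsto_natCast_atTop_atTop).const_mul_atTop (by positivity)
    obtain ⟨N, h1, h2⟩ := ((Filter.eventually_ge_atTop 1).and (h.eventually_lt_const hδ')).exists
    refine ⟨N, h1, ?_⟩
    have h3 : τ * N / 2 = τ / 2 * N := by ring
    rw [h3]
    exact h2
  obtain ⟨C, hC, hcard⟩ := gv (Fin M) N τ _ hτ0.le (hball N)
  rw [Fintype.card_fin] at hcard
  set w : Fin C.card → Fin N → Fin M := fun k => C.equivFin.symm k with hw
  have hwinj : Function.Injective w := fun a b h => C.equivFin.symm.injective (Subtype.ext h)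
  have hwC : ∀ k, w k ∈ C := fun k => (C.equivFin.symm k).2
  have hWn0 : ∀ a z, 0 ≤ Wn W n (c a) z := fun a z =>
    Finset.prod_nonneg fun j _ => hW0 _ (hc a j) _
  refine ⟨N * n, C.card, fun k => (blk N n Y).symm fun i => c (w k i), Nat.mul_pos hN1 hn, ?_, ?_, ?_⟩
  · intro m j
    simp [blk, Function.uncurry, hc]
  · have h1 : Real.exp ((N * n : ℕ) * (Real.log M / n - δ)) * Real.exp (δ * n * N) = (M:ℝ) ^ N := by
      rw [← Real.exp_add, ← Real.exp_log (by positivity : (0:ℝ) < (M:ℝ) ^ N), Real.log_pow]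
      congr 1
      push_cast
      field_simp
      ring_nf
    rw [← h1] at hcard
    exact le_of_mul_le_mul_right hcard (Real.exp_pos _)
  · intro k
    refine lt_of_le_of_lt ?_ hN
    have hch := chernoff (fun i => Wn W n (c (w k i))) (fun i => c (w k i)) (fun i z => hWn0 _ z)
      (fun i => sum_Wn W n _ fun j => hW1 _ (hc _ j)) (n * ε) τ (by positivity) (fun i => by
        have hε1 : ε ≤ 1 := by nlinarith
        calc 1 - n * ε = 1 + n * (-ε) := by ring
          _ ≤ (1 + (-ε)) ^ n := one_add_mul_le_pow (by linarith) n
          _ = ∏ _j : Fin n, (1 - ε) := by simp [sub_eq_add_neg]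
          _ ≤ _ := Finset.prod_le_prod (fun j _ => by linarith) fun j _ => hWε _ (hc _ j))
      (by linarith)
    refine le_trans ?_ hch
    unfold erasureProb
    rw [Finset.sum_filter, Finset.sum_filter, ← (blk N n Y).symm.sum_comp]
    refine Finset.sum_le_sum fun z _ => ?_
    simp only [Wn_blk]
    have hnn : 0 ≤ ∏ i, Wn W n (c (w k i)) (z i) := Finset.prod_nonneg fun i _ => hWn0 _ _
    by_cases hfar : τ * N < nd z (fun i => c (w k i))
    · rw [if_pos hfar]
      split_ifs <;> linarith
    · rw [if_neg hfar, if_neg]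
      intro hlt
      apply hfar
      obtain ⟨k', hk', hne⟩ := Finset.exists_mem_ne hlt k
      have hk' := (Finset.mem_filter.1 hk').2
      have hd := hC (w k') (hwC k') (w k) (hwC k) (fun h => hne (hwinj h))
      refine lt_of_lt_of_le hd ?_
      unfold nd
      have hsub : (Finset.univ.filter fun i => w k' i ≠ w k i) ⊆
          Finset.univ.filter fun i => z i ≠ c (w k i) := by
        intro i hi
        have hi := (Finset.mem_filter.1 hi).2
        refine Finset.mem_filter.2 ⟨Finset.mem_univ _, fun hz => ?_⟩
        obtain ⟨j, hj⟩ := hs (w k i) (w k' i) (Ne.symm hi)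
        have hpos : 0 < Wn W n (c (w k' i)) (z i) := by
          refine lt_of_le_of_ne (hWn0 _ _) fun h0 => ?_
          rw [Finset.prod_eq_zero (Finset.mem_univ i) h0.symm] at hk'
          exact lt_irrefl _ hk'
        rw [Wn_pos_iff W n _ _ fun j => hW0 _ (hc _ j) _] at hpos
        have := hpos j
        rw [hz, hWS _ (hc _ j)] at this
        exact hj this
      exact_mod_cast Finset.card_le_card hsub

/-- As the noise vanishes, the zero-undetected-error capacity tends to the
Sperner capacity, uniformly over all `ε`-noise channels with a given support. -/
theorem zue_capacity_tendsto_sperner {Y : Type*} [Fintype Y] (X : Finset Y)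
    (hX : X.Nonempty) (S : Finset (Y × Y))
    (hSX : ∀ p ∈ S, p.1 ∈ X) (hdiag : ∀ x ∈ X, (x, x) ∈ S) :
    ∀ δ : ℝ, 0 < δ → ∃ ε₀ : ℝ, 0 < ε₀ ∧ ε₀ < 1 ∧
      ∀ ε : ℝ, 0 ≤ ε → ε < ε₀ →
        ∀ W : Y → Y → ℝ,
          (∀ x ∈ X, ∀ y, 0 ≤ W x y) →
          (∀ x ∈ X, ∑ y, W x y = 1) →
          (∀ x ∈ X, 1 - ε ≤ W x x) →
          (∀ x ∈ X, ∀ y, (0 < W x y ↔ (x, y) ∈ S)) →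
          |Ceo X W - CspSupp X S| ≤ δ := by
  intro δ hδ
  have hbdd := csp_bdd X hX S hdiag
  obtain ⟨r, ⟨n, M, c, hn, hM, hc, hs, rfl⟩, hr⟩ :=
    exists_lt_of_lt_csSup ⟨0, csp_mem_zero X hX S⟩
      (show CspSupp X S - δ / 2 < CspSupp X S by linarith)
  obtain ⟨ε₁, hε₁, hlow⟩ := lower X S n M c hn hM hc hs (δ / 2) (by linarith)
  obtain ⟨ε₂, hε₂, hup⟩ := upper X hX S hdiag δ hδ
  refine ⟨min (1 / 2) (min ε₁ ε₂), by positivity, lt_of_le_of_lt (min_le_left _ _) (by norm_num), ?_⟩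
  intro ε hε hlt W hW0 hW1 hWε hWS
  have h1 : ε < ε₁ := hlt.trans_le ((min_le_right _ _).trans (min_le_left _ _))
  have h2 : ε < ε₂ := hlt.trans_le ((min_le_right _ _).trans (min_le_right _ _))
  have hU := hup ε hε h2 W hW0 hW1 hWε hWS
  have hL := hlow ε hε h1 W hW0 hW1 hWε hWS
  have hle : Ceo X W ≤ CspSupp X S + δ := csSup_le ⟨0, Set.mem_insert _ _⟩ hU
  have hb := (⟨_, hU⟩ : BddAbove _)
  have hge : CspSupp X S - δ ≤ Ceo X W := by
    by_cases h : 0 ≤ Real.log M / n - δ / 2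
    · have : Real.log M / n - δ / 2 ≤ Ceo X W := le_csSup hb (Set.mem_insert_of_mem _ ⟨h, hL⟩)
      linarith
    · have : 0 ≤ Ceo X W := le_csSup hb (Set.mem_insert _ _)
      linarith
  rw [abs_le]
  constructor <;> linarith
end
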